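/- Let (X,d,≤) be a quasi-ordered metric space which is complete (every ascending Cauchy sequence converges), let T : X → X be ≤-increasing with {x ∈ X : x ≤ Tx} nonempty, and suppose that either T is ≤-continuous or the relation ≤ is self-closed. Let F : [0,∞)^6 → ℝ be compatible, lower semicontinuous on [0,∞)^6, (3,4)-normal (F(r,r,0,0,r,r) > 0 for all r > 0) and (2,3,6)-normal (F(r,0,0,r,r,0) > 0 for all r > 0), and assume T is (d,≤;M;F)-contractive, i.e. F(d(Tx,Ty), d(x,y), d(x,Tx), d(y,Ty), d(x,Ty), d(Tx,y)) ≤ 0 for all x,y ∈ X with x ≤ y and x ≠ y. Then T is a global Picard operator modulo (d,≤): for every x ∈ X with x ≤ Tx the sequence (T^n x) converges to a fixed point of T, and any two fixed points z, w of T with z ≤ w are equal. -/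

import Mathlib

open Filter Topology
open scoped NNReal

/-- `F : [0,∞)^6 → ℝ` is compatible: for all sequences `(r n)` in `(0,∞)` and `(s n)` in
`[0,∞)` with `F (r (n+1)) (r n) (r n) (r (n+1)) (s n) 0 ≤ 0` and `|s n - r n| ≤ r (n+1)`
for all `n`, one has `r n → 0`. -/
def FCompatible (F : ℝ≥0 → ℝ≥0 → ℝ≥0 → ℝ≥0 → ℝ≥0 → ℝ≥0 → ℝ) : Prop :=
  ∀ r s : ℕ → ℝ≥0, (∀ n, 0 < r n) →
    (∀ n, F (r (n + 1)) (r n) (r n) (r (n + 1)) (s n) 0 ≤ 0) →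
    (∀ n, |(s n : ℝ) - (r n : ℝ)| ≤ (r (n + 1) : ℝ)) →
    Filter.Tendsto r Filter.atTop (nhds 0)

/-- `F` is lower semicontinuous on `[0,∞)^6` (sequential form). -/
def LscSix (F : ℝ≥0 → ℝ≥0 → ℝ≥0 → ℝ≥0 → ℝ≥0 → ℝ≥0 → ℝ) : Prop :=
  ∀ (t₁ t₂ t₃ t₄ t₅ t₆ : ℕ → ℝ≥0) (a₁ a₂ a₃ a₄ a₅ a₆ : ℝ≥0),
    Filter.Tendsto t₁ Filter.atTop (nhds a₁) →
    Filter.Tendsto t₂ Filter.atTop (nhds a₂) →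
    Filter.Tendsto t₃ Filter.atTop (nhds a₃) →
    Filter.Tendsto t₄ Filter.atTop (nhds a₄) →
    Filter.Tendsto t₅ Filter.atTop (nhds a₅) →
    Filter.Tendsto t₆ Filter.atTop (nhds a₆) →
    F a₁ a₂ a₃ a₄ a₅ a₆ ≤
      Filter.liminf (fun n => F (t₁ n) (t₂ n) (t₃ n) (t₄ n) (t₅ n) (t₆ n)) Filter.atTop

theorem lsc_nonpos {F : ℝ≥0 → ℝ≥0 → ℝ≥0 → ℝ≥0 → ℝ≥0 → ℝ≥0 → ℝ} (hFlsc : LscSix F)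
    {t₁ t₂ t₃ t₄ t₅ t₆ : ℕ → ℝ≥0} {a₁ a₂ a₃ a₄ a₅ a₆ : ℝ≥0}
    (h : ∀ᶠ n in atTop, F (t₁ n) (t₂ n) (t₃ n) (t₄ n) (t₅ n) (t₆ n) ≤ 0)
    (h₁ : Tendsto t₁ atTop (nhds a₁)) (h₂ : Tendsto t₂ atTop (nhds a₂))
    (h₃ : Tendsto t₃ atTop (nhds a₃)) (h₄ : Tendsto t₄ atTop (nhds a₄))
    (h₅ : Tendsto t₅ atTop (nhds a₅)) (h₆ : Tendsto t₆ atTop (nhds a₆)) :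
    F a₁ a₂ a₃ a₄ a₅ a₆ ≤ 0 := by
  refine (hFlsc _ _ _ _ _ _ _ _ _ _ _ _ h₁ h₂ h₃ h₄ h₅ h₆).trans ?_
  rw [liminf_eq]
  apply Real.sSup_nonpos
  intro a ha
  obtain ⟨n, h1, h2⟩ := (Filter.Eventually.and ha h).exists
  exact le_trans h1 h2

theorem tendsto_nndist_perturb {X : Type*} [MetricSpace X] {u v u' v' : ℕ → X} {e : ℝ≥0}
    (h : Tendsto (fun n => nndist (u n) (v n)) atTop (nhds e))
    (hu : Tendsto (fun n => nndist (u n) (u' n)) atTop (nhds 0))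
    (hv : Tendsto (fun n => nndist (v n) (v' n)) atTop (nhds 0)) :
    Tendsto (fun n => nndist (u' n) (v' n)) atTop (nhds e) := by
  rw [← NNReal.tendsto_coe] at *
  simp only [coe_nndist, NNReal.coe_zero] at *
  have hs := hu.add hv
  rw [add_zero] at hs
  have hd : Tendsto (fun n => dist (u n) (v n) - dist (u' n) (v' n)) atTop (nhds 0) :=
    squeeze_zero_norm (fun n => dist_dist_dist_le (u n) (v n) (u' n) (v' n)) hs
  have := h.sub hd
  simpa using this

/-- **Theorem 5.1.**
Let `(X, d, le)` be a quasi-ordered metric space, complete for ascending Cauchy sequences,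
`T` a `le`-increasing selfmap with `{x : le x (T x)}` nonempty, and assume either `T` is
`le`-continuous or `le` is self-closed.  If `F : [0,∞)^6 → ℝ` is compatible, lower
semicontinuous, (3,4)-normal and (2,3,6)-normal, and `T` is `(d, le; M; F)`-contractive,
then `T` is a global Picard operator. -/
theorem global_picard_of_lsc_implicit_contraction
    {X : Type*} [MetricSpace X]
    (le : X → X → Prop)
    (hrefl : ∀ x, le x x)
    (htrans : ∀ x y z, le x y → le y z → le x z)
    (hcomplete : ∀ x : ℕ → X, (∀ n, le (x n) (x (n + 1))) → CauchySeq x →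
      ∃ a, Tendsto x atTop (nhds a))
    (T : X → X)
    (hmono : ∀ x y, le x y → le (T x) (T y))
    (hne : ∃ x, le x (T x))
    (hreg :
      (∀ (x : ℕ → X) (a : X), (∀ n, le (x n) (x (n + 1))) →
        Tendsto x atTop (nhds a) →
        Tendsto (fun n => T (x n)) atTop (nhds (T a)))
      ∨
      (∀ (x : ℕ → X) (a : X), (∀ n, le (x n) (x (n + 1))) →
        Tendsto x atTop (nhds a) → ∀ n, le (x n) a))
    (F : ℝ≥0 → ℝ≥0 → ℝ≥0 → ℝ≥0 → ℝ≥0 → ℝ≥0 → ℝ)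
    (hFcomp : FCompatible F)
    (hFlsc : LscSix F)
    (hF34 : ∀ r : ℝ≥0, 0 < r → 0 < F r r 0 0 r r)
    (hF236 : ∀ r : ℝ≥0, 0 < r → 0 < F r 0 0 r r 0)
    (hcontr : ∀ x y, le x y → x ≠ y →
      F (nndist (T x) (T y)) (nndist x y) (nndist x (T x)) (nndist y (T y))
        (nndist x (T y)) (nndist (T x) y) ≤ 0) :
    (∀ x, le x (T x) →
      ∃ z, Tendsto (fun n => T^[n] x) atTop (nhds z) ∧ T z = z) ∧
    (∀ z w, T z = z → T w = w → le z w → z = w) := by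
  refine ⟨?_, ?_⟩
  swap
  · intro z w hz hw hzw
    by_contra hne'
    have h := hcontr z w hzw hne'
    rw [hz, hw, nndist_self, nndist_self] at h
    exact absurd h (not_le.2 (hF34 _ (by simpa [pos_iff_ne_zero] using hne')))
  intro x0 hx0
  obtain ⟨x, hx⟩ : ∃ x : ℕ → X, x = fun n => T^[n] x0 := ⟨_, rfl⟩
  rw [← hx]
  have hxs : ∀ n, x (n + 1) = T (x n) := fun n => by
    simp only [hx, Function.iterate_succ_apply']
  have hasc : ∀ n, le (x n) (x (n + 1)) := by
    intro n
    induction n with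
    | zero => simpa [hx] using hx0
    | succ k ih => rw [hxs (k + 1), hxs k]; exact hmono _ _ (by rw [← hxs]; exact ih)
  have hlt : ∀ m n, m ≤ n → le (x m) (x n) := by
    intro m n hmn
    induction n, hmn using Nat.le_induction with
    | base => exact hrefl _
    | succ k _ ih => exact htrans _ _ _ ih (hasc k)
  by_cases hfix : ∃ n, x n = x (n + 1)
  · obtain ⟨n, hn⟩ := hfix
    have hT : T (x n) = x n := by rw [← hxs]; exact hn.symm
    refine ⟨x n, ?_, hT⟩
    apply tendsto_atTop_of_eventually_const (i₀ := n)
    intro k hk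
    induction k, hk using Nat.le_induction with
    | base => rfl
    | succ k _ ih => rw [hxs, ih, hT]
  push Not at hfix
  have hr : Tendsto (fun n => nndist (x n) (x (n + 1))) atTop (nhds 0) := by
    apply hFcomp _ (fun n => nndist (x n) (x (n + 2)))
    · intro n
      simpa [pos_iff_ne_zero] using hfix n
    · intro n
      have h := hcontr _ _ (hasc n) (hfix n)
      rw [← hxs, ← hxs, nndist_self] at h
      exact h
    · intro n
      simp only [coe_nndist]
      rw [dist_comm (x n) (x (n + 2)), dist_comm (x n) (x (n + 1)), dist_comm (x (n + 1)) (x (n + 1 + 1))]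
      exact abs_dist_sub_le _ _ _
  have hC : CauchySeq x := by
    by_contra hnc
    rw [Metric.cauchySeq_iff'] at hnc
    push Not at hnc
    obtain ⟨e, he, H⟩ := hnc
    have key : ∀ N, ∃ k, N ≤ k ∧ dist (x N) (x k) < e ∧ e ≤ dist (x N) (x (k + 1)) := by
      intro N
      by_contra hk
      push Not at hk
      have : ∀ n, N ≤ n → dist (x N) (x n) < e := by
        intro n hn
        induction n, hn using Nat.le_induction with
        | base => simpa using he
        | succ k hNk ih => exact hk k hNk ih
      obtain ⟨n, hn, h⟩ := H N
      have := this n hn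
      rw [dist_comm] at this
      linarith
    choose k hk1 hk2 hk3 using key
    have hkt : Tendsto k atTop atTop := tendsto_atTop_mono hk1 tendsto_id
    have hrk : Tendsto (fun n => nndist (x (k n)) (x (k n + 1))) atTop (nhds 0) := hr.comp hkt
    have hrk1 : Tendsto (fun n => nndist (x (k n + 1)) (x (k n + 1 + 1))) atTop (nhds 0) :=
      hr.comp ((tendsto_add_atTop_nat 1).comp hkt)
    lift e to ℝ≥0 using he.le
    have hd : Tendsto (fun n => nndist (x n) (x (k n + 1))) atTop (nhds e) := by
      rw [← NNReal.tendsto_coe] at hrk ⊢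
      simp only [coe_nndist, NNReal.coe_zero] at *
      refine tendsto_of_tendsto_of_tendsto_of_le_of_le (h := fun n => (e : ℝ) + dist (x (k n)) (x (k n + 1))) tendsto_const_nhds ?_ hk3 ?_
      · simpa using hrk.const_add (e : ℝ)
      · intro n
        have := dist_triangle (x n) (x (k n)) (x (k n + 1))
        have := hk2 n
        simp only
        linarith
    have h0 : ∀ u : ℕ → X, Tendsto (fun n => nndist (u n) (u n)) atTop (nhds 0) := by
      intro u; simp
    have hb := lsc_nonpos hFlsc (Eventually.of_forall fun n => by
        have h := hcontr (x n) (x (k n + 1)) (hlt _ _ ((hk1 n).trans (Nat.le_succ _))) (by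
          intro heq
          have := hk3 n
          rw [heq, dist_self] at this
          linarith)
        rw [← hxs, ← hxs] at h
        exact h)
      (tendsto_nndist_perturb hd hr hrk1) hd hr hrk1
      (tendsto_nndist_perturb hd (h0 _) hrk1) (tendsto_nndist_perturb hd hr (h0 _))
    exact absurd hb (not_le.2 (hF34 e (by exact_mod_cast he)))
  obtain ⟨z, hz⟩ := hcomplete x hasc hC
  refine ⟨z, hz, ?_⟩
  have hz1 : Tendsto (fun n => x (n + 1)) atTop (nhds z) := hz.comp (tendsto_add_atTop_nat 1)
  rcases hreg with hc | hsc
  · have h := hc x z hasc hz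
    simp only [← hxs] at h
    exact tendsto_nhds_unique h hz1
  · by_contra hne'
    have hpos : 0 < nndist z (T z) := by
      simpa [pos_iff_ne_zero] using fun h : z = T z => hne' h.symm
    have hev : ∀ᶠ n in atTop, x n ≠ z := by
      filter_upwards [hr.eventually_lt_const hpos] with n hn heq
      rw [hxs, heq] at hn
      exact lt_irrefl _ hn
    have hb := lsc_nonpos hFlsc (hev.mono fun n hn => by
        have h := hcontr (x n) z (hsc x z hasc hz n) hn
        rw [← hxs] at h
        exact h)
      (hz1.nndist (tendsto_const_nhds (x := T z))) (hz.nndist (tendsto_const_nhds (x := z))) hr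
      tendsto_const_nhds
      (hz.nndist (tendsto_const_nhds (x := T z))) (hz1.nndist (tendsto_const_nhds (x := z)))
    rw [nndist_self] at hb
    exact absurd hb (not_le.2 (hF236 _ hpos))
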